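/- arXiv:2505.00246 — 6 statements merged into one kernel-verified Lean document; each statement's English description precedes it below -/
import Mathlib

section
/- Let A be a commutative ring, w ≥ 1, let R₂ = A[x,y] and R₃ = A[x,y,z] be polynomial rings, and let ι : R₂ → R₃ be the natural inclusion (renaming of variables). Let I be an ideal of R₂, let f ∈ R₂, and let g be a unit of R₂. Define the ideal J of R₃ as the sum of the image ideal Ideal.map ι I and the principal ideal generated by ι(f) − z·ι(g). Then y·z + x^w ∈ J if and only if y·f + x^w·g ∈ I. -/
open MvPolynomial

/-- Substituting `f / g` for the last variable is a retraction of `R₃ → R₂` sending the graph ideal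
over `I` into `I`. -/
theorem map_sup_span_graph_le_comap_aeval {A : Type*} [CommRing A] {n : ℕ}
    (I : Ideal (MvPolynomial (Fin n) A)) (f : MvPolynomial (Fin n) A)
    (g : (MvPolynomial (Fin n) A)ˣ) :
    Ideal.map (rename (Fin.castSucc : Fin n → Fin (n + 1))) I ⊔
        Ideal.span {rename Fin.castSucc f -
          X (Fin.last n) * rename Fin.castSucc (g : MvPolynomial (Fin n) A)} ≤
      I.comap (aeval (R := A) (Fin.snoc X (f * ↑g⁻¹) : Fin (n + 1) → MvPolynomial (Fin n) A)) := by
  have retract (p : MvPolynomial (Fin n) A) :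
      aeval (Fin.snoc X (f * ↑g⁻¹) : Fin (n + 1) → MvPolynomial (Fin n) A)
        (rename Fin.castSucc p) = p := by
    rw [aeval_rename]
    convert aeval_X_left_apply p
    ext1 i
    simp
  refine sup_le (Ideal.map_le_iff_le_comap.2 fun p hp => ?_) ?_
  · simpa only [Ideal.mem_comap, retract] using hp
  · rw [Ideal.span_singleton_le_iff_mem, Ideal.mem_comap, map_sub, map_mul, retract, retract]
    simp

/-- **Lifting along the graph of `z = f/g` and the `A_{w-1}` surface equation**
(algebraic core of Theorem 4.12(1) of the paper).
Let `R₂ = A[x,y]`, `R₃ = A[x,y,z]`, `ι : R₂ → R₃` the natural inclusion,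
`I` an ideal of `R₂`, `f ∈ R₂` and `g` a unit of `R₂`.  If
`J = ι(I)·R₃ + (ι f − z·ι g)` then `y·z + x^w ∈ J ↔ y·f + x^w·g ∈ I`.
Here `x = X 0`, `y = X 1`, `z = X 2`. -/
theorem mem_graph_lift_ideal_iff (A : Type*) [CommRing A] (w : ℕ) (hw : 1 ≤ w)
    (I : Ideal (MvPolynomial (Fin 2) A)) (f : MvPolynomial (Fin 2) A)
    (g : (MvPolynomial (Fin 2) A)ˣ) :
    MvPolynomial.X 1 * MvPolynomial.X 2 + MvPolynomial.X 0 ^ w ∈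
        (Ideal.map (MvPolynomial.rename (Fin.castSucc : Fin 2 → Fin 3)) I ⊔
          Ideal.span {MvPolynomial.rename (Fin.castSucc : Fin 2 → Fin 3) f -
            MvPolynomial.X 2 *
              MvPolynomial.rename (Fin.castSucc : Fin 2 → Fin 3)
                (g : MvPolynomial (Fin 2) A)}) ↔
      MvPolynomial.X 1 * f + MvPolynomial.X 0 ^ w * (g : MvPolynomial (Fin 2) A) ∈ I := by
  constructor
  · intro h
    have h' := map_sup_span_graph_le_comap_aeval I f g h
    have hx : (Fin.snoc X (f * ↑g⁻¹) : Fin 3 → MvPolynomial (Fin 2) A) 0 = X 0 := rfl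
    have hy : (Fin.snoc X (f * ↑g⁻¹) : Fin 3 → MvPolynomial (Fin 2) A) 1 = X 1 := rfl
    have hz : (Fin.snoc X (f * ↑g⁻¹) : Fin 3 → MvPolynomial (Fin 2) A) 2 = f * ↑g⁻¹ := rfl
    rw [Ideal.mem_comap, map_add, map_mul, map_pow, aeval_X, aeval_X, aeval_X, hx, hy, hz] at h'
    convert I.mul_mem_right (g : MvPolynomial (Fin 2) A) h' using 1
    linear_combination -(X 1 * f) * g.inv_mul
  · intro h
    have hg : IsUnit (rename (Fin.castSucc : Fin 2 → Fin 3) (g : MvPolynomial (Fin 2) A)) :=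
      g.isUnit.map _
    rw [← Ideal.unit_mul_mem_iff_mem _ hg]
    have hI := Ideal.mem_map_of_mem (rename (R := A) (Fin.castSucc : Fin 2 → Fin 3)) h
    have hgraph := Ideal.mem_span_singleton_self
      (rename (Fin.castSucc : Fin 2 → Fin 3) f -
        X 2 * rename (Fin.castSucc : Fin 2 → Fin 3) (g : MvPolynomial (Fin 2) A))
    convert Ideal.sub_mem _ (Ideal.mem_sup_left hI)
      (Ideal.mem_sup_right (Ideal.mul_mem_left _ (X 1) hgraph)) using 1
    simp only [map_add, map_mul, map_pow, rename_X, Fin.castSucc_zero, Fin.castSucc_one]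
    ring
end

section
/- Let A be a commutative ring, let R₂ = A[x,y] and R₃ = A[x,y,z] be polynomial rings, and let ι : R₂ → R₃ be the natural inclusion. Let I be an ideal of R₂, let f ∈ R₂, and let g be a unit of R₂. Define J to be the sum of Ideal.map ι I and the principal ideal generated by ι(f) − z·ι(g). Then Ideal.comap ι J = I; that is, for every p ∈ R₂ one has ι(p) ∈ J if and only if p ∈ I. -/
open MvPolynomial

/-- If `φ` is a left inverse of `ι` that kills `r`, then the ideal generated by `ι(I)` and `r`
contracts to `I` along `ι`. -/
theorem comap_map_sup_span_singleton_of_retraction {A R S : Type*} [CommRing A] [CommRing R]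
    [CommRing S] [Algebra A R] [Algebra A S] (ι : R →ₐ[A] S) (φ : S →ₐ[A] R)
    (h : ∀ p, φ (ι p) = p) (I : Ideal R) {r : S} (hr : φ r = 0) :
    Ideal.comap ι (Ideal.map ι I ⊔ Ideal.span {r}) = I := by
  refine le_antisymm (fun p hp => ?_) fun p hp =>
    Ideal.mem_sup_left (Ideal.mem_map_of_mem ι hp)
  have hle : Ideal.map ι I ⊔ Ideal.span {r} ≤ Ideal.comap φ I := by
    refine sup_le (Ideal.map_le_iff_le_comap.mpr fun q hq => ?_) ?_
    · simpa [Ideal.mem_comap, h] using hq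
    · simp [Ideal.mem_comap, hr]
  simpa [Ideal.mem_comap, h] using hle hp

/-- **Contraction of the graph-ideal lift** (used in the proof of Theorem 4.12(1) of
the paper).  Let `R₂ = A[x,y]`, `R₃ = A[x,y,z]`, `ι : R₂ → R₃` the natural inclusion,
`I` an ideal of `R₂`, `f ∈ R₂` and `g` a unit of `R₂`.  If
`J = ι(I)·R₃ + (ι f − z·ι g)` then `ι⁻¹(J) = I`, i.e. for every `p ∈ R₂`,
`ι p ∈ J ↔ p ∈ I`.  Here `x = X 0`, `y = X 1`, `z = X 2`. -/
theorem comap_graph_lift_ideal (A : Type*) [CommRing A]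
    (I : Ideal (MvPolynomial (Fin 2) A)) (f : MvPolynomial (Fin 2) A)
    (g : (MvPolynomial (Fin 2) A)ˣ) :
    Ideal.comap (MvPolynomial.rename (Fin.castSucc : Fin 2 → Fin 3))
        (Ideal.map (MvPolynomial.rename (Fin.castSucc : Fin 2 → Fin 3)) I ⊔
          Ideal.span {MvPolynomial.rename (Fin.castSucc : Fin 2 → Fin 3) f -
            MvPolynomial.X 2 *
              MvPolynomial.rename (Fin.castSucc : Fin 2 → Fin 3)
                (g : MvPolynomial (Fin 2) A)}) = I := by
  let φ : MvPolynomial (Fin 3) A →ₐ[A] MvPolynomial (Fin 2) A :=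
    aeval (Fin.snoc (α := fun _ => MvPolynomial (Fin 2) A) X
      ((g⁻¹ : (MvPolynomial (Fin 2) A)ˣ) * f))
  have hφ : ∀ p, φ (rename Fin.castSucc p) = p := fun p => by
    have hX : (Fin.snoc (α := fun _ => MvPolynomial (Fin 2) A) X
        ((g⁻¹ : (MvPolynomial (Fin 2) A)ˣ) * f)) ∘ Fin.castSucc = X :=
      funext fun _ => Fin.snoc_castSucc _ _ _
    rw [aeval_rename, hX, aeval_X_left_apply]
  have hz : φ (X 2) = (g⁻¹ : (MvPolynomial (Fin 2) A)ˣ) * f :=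
    (aeval_X _ _).trans (Fin.snoc_last _ _)
  refine comap_map_sup_span_singleton_of_retraction _ φ hφ I ?_
  rw [map_sub, map_mul, hφ, hφ, hz, mul_right_comm, Units.inv_mul, one_mul, sub_self]
end

section
/- For all s, t, k, l, m, n ∈ ℂ, the polynomial F = (y² + x⁴) + s·x·(y + x³) + t·(y + x⁴) in ℂ[x,y] belongs to the ideal generated by y − k·x − l and x² − m·x − n if and only if both of the following equations hold: n·(s·m² + s·k + k² + m²) + t·m²·n + t·l + l² + n²·(1 + s + t) = 0 and m·(s·m² + s·k + k² + m²) + t·m³ + t·k + s·l + 2·k·l + 2·m·n·(1 + s + t) = 0. -/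
open MvPolynomial

/-- An affine polynomial `a + b·x` lies in the ideal `⟨y − k·x − l, x² − m·x − n⟩` only if it
vanishes. -/
theorem eq_zero_of_affine_mem_span (a b k l m n : ℂ)
    (h : (C a + C b * X 0 : MvPolynomial (Fin 2) ℂ) ∈
      Ideal.span {X 1 - C k * X 0 - C l, X 0 ^ 2 - C m * X 0 - C n}) :
    a = 0 ∧ b = 0 := by
  obtain ⟨p, q, hpq⟩ := Ideal.mem_span_pair.mp h
  let φ : MvPolynomial (Fin 2) ℂ →ₐ[ℂ] Polynomial ℂ :=
    aeval ![Polynomial.X, Polynomial.C k * Polynomial.X + Polynomial.C l]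
  have hφ := congrArg φ hpq
  simp only [φ, map_add, map_mul, map_sub, map_pow, aeval_X, algHom_C, Matrix.cons_val_zero,
    Matrix.cons_val_one, Polynomial.algebraMap_eq] at hφ
  have hdvd : (Polynomial.X ^ 2 - (Polynomial.C m * Polynomial.X + Polynomial.C n)) ∣
      Polynomial.C b * Polynomial.X + Polynomial.C a :=
    ⟨φ q, by linear_combination -hφ⟩
  have hdeg : (Polynomial.C b * Polynomial.X + Polynomial.C a).degree <
      (Polynomial.X ^ 2 - (Polynomial.C m * Polynomial.X + Polynomial.C n)).degree := by
    have hlin (c d : ℂ) : (Polynomial.C c * Polynomial.X + Polynomial.C d).degree < ((2 : ℕ) : WithBot ℕ) :=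
      Polynomial.degree_linear_le.trans_lt (by norm_num)
    rw [Polynomial.degree_sub_eq_left_of_degree_lt] <;> rw [Polynomial.degree_X_pow]
    exacts [hlin b a, hlin m n]
  have hzero := Polynomial.eq_zero_of_dvd_of_degree_lt hdvd hdeg
  have h₀ := congrArg (Polynomial.coeff · 0) hzero
  have h₁ := congrArg (Polynomial.coeff · 1) hzero
  exact ⟨by simpa using h₀, by simpa using h₁⟩

/-- **Explicit equations of the relative Hilbert scheme** (Section 4.1 of the paper).
For `s, t, k, l, m, n ∈ ℂ`, the polynomial
`F = (y² + x⁴) + s·x·(y + x³) + t·(y + x⁴)` lies in the ideal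
`⟨y − k·x − l, x² − m·x − n⟩` of `ℂ[x,y]` if and only if the two explicit equations
hold.  Here `x = X 0`, `y = X 1`. -/
theorem hilbert_scheme_equations (s t k l m n : ℂ) :
    ((MvPolynomial.X 1 ^ 2 + MvPolynomial.X 0 ^ 4) +
        MvPolynomial.C s * MvPolynomial.X 0 * (MvPolynomial.X 1 + MvPolynomial.X 0 ^ 3) +
        MvPolynomial.C t * (MvPolynomial.X 1 + MvPolynomial.X 0 ^ 4) ∈
      Ideal.span {MvPolynomial.X 1 - MvPolynomial.C k * MvPolynomial.X 0 - MvPolynomial.C l,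
        MvPolynomial.X 0 ^ 2 - MvPolynomial.C m * MvPolynomial.X 0 - MvPolynomial.C n
          (R := ℂ) (σ := Fin 2)}) ↔
    (n * (s * m ^ 2 + s * k + k ^ 2 + m ^ 2) + t * m ^ 2 * n + t * l + l ^ 2 +
        n ^ 2 * (1 + s + t) = 0 ∧
      m * (s * m ^ 2 + s * k + k ^ 2 + m ^ 2) + t * m ^ 3 + t * k + s * l + 2 * k * l +
        2 * m * n * (1 + s + t) = 0) := by
  set a := n * (s * m ^ 2 + s * k + k ^ 2 + m ^ 2) + t * m ^ 2 * n + t * l + l ^ 2 +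
    n ^ 2 * (1 + s + t) with ha
  set b := m * (s * m ^ 2 + s * k + k ^ 2 + m ^ 2) + t * m ^ 3 + t * k + s * l + 2 * k * l +
    2 * m * n * (1 + s + t) with hb
  set I : Ideal (MvPolynomial (Fin 2) ℂ) :=
    Ideal.span {X 1 - C k * X 0 - C l, X 0 ^ 2 - C m * X 0 - C n}
  have hdiv : ((X 1 ^ 2 + X 0 ^ 4) + C s * X 0 * (X 1 + X 0 ^ 3) + C t * (X 1 + X 0 ^ 4)) -
      (C a + C b * X 0) ∈ I := by
    refine Ideal.mem_span_pair.mpr ⟨X 1 + C k * X 0 + C l + C s * X 0 + C t,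
      (1 + C s + C t) * (X 0 ^ 2 + C m * X 0 + C n + C m ^ 2) + C k ^ 2 + C s * C k, ?_⟩
    simp only [ha, hb, map_add, map_mul, map_pow, map_one, map_ofNat]
    ring
  constructor
  · intro hF
    exact eq_zero_of_affine_mem_span a b k l m n (by simpa using I.sub_mem hF hdiv)
  · rintro ⟨h₀, h₁⟩
    simpa [h₀, h₁] using hdiv
end

section
/- Let s, t, k, l, m, n ∈ ℂ with 1 + s + t ≠ 0, and set s′ = (1 + s + t)⁻¹·(s + k) and t′ = (1 + s + t)⁻¹·(t + l). Then (y² + x⁴) + s·x·(y + x³) + t·(y + x⁴) belongs to the ideal of ℂ[x,y] generated by y − k·x − l and x² − m·x − n if and only if y·z + x⁴ belongs to the ideal of ℂ[x,y,z] generated by z − s′·x − t′, y − k·x − l and x² − m·x − n. -/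
open MvPolynomial

/-- **Key equivalence of Section 4.1 of the paper.**
For `s, t, k, l, m, n ∈ ℂ` with `1 + s + t ≠ 0`, setting
`s′ = (1 + s + t)⁻¹·(s + k)` and `t′ = (1 + s + t)⁻¹·(t + l)`, the polynomial
`(y² + x⁴) + s·x·(y + x³) + t·(y + x⁴)` lies in the ideal
`⟨y − k·x − l, x² − m·x − n⟩` of `ℂ[x,y]` if and only if `y·z + x⁴` lies in the ideal
`⟨z − s′·x − t′, y − k·x − l, x² − m·x − n⟩` of `ℂ[x,y,z]`.
Here `x = X 0`, `y = X 1` (and `z = X 2` in `ℂ[x,y,z]`). -/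
theorem hilbert_scheme_trick (s t k l m n : ℂ) (h : 1 + s + t ≠ 0) :
    ((MvPolynomial.X 1 ^ 2 + MvPolynomial.X 0 ^ 4) +
        MvPolynomial.C s * MvPolynomial.X 0 * (MvPolynomial.X 1 + MvPolynomial.X 0 ^ 3) +
        MvPolynomial.C t * (MvPolynomial.X 1 + MvPolynomial.X 0 ^ 4) ∈
      Ideal.span {MvPolynomial.X 1 - MvPolynomial.C k * MvPolynomial.X 0 - MvPolynomial.C l,
        MvPolynomial.X 0 ^ 2 - MvPolynomial.C m * MvPolynomial.X 0 - MvPolynomial.C n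
          (R := ℂ) (σ := Fin 2)}) ↔
    (MvPolynomial.X 1 * MvPolynomial.X 2 + MvPolynomial.X 0 ^ 4 ∈
      Ideal.span {MvPolynomial.X 2 - MvPolynomial.C ((1 + s + t)⁻¹ * (s + k)) * MvPolynomial.X 0 -
          MvPolynomial.C ((1 + s + t)⁻¹ * (t + l)),
        MvPolynomial.X 1 - MvPolynomial.C k * MvPolynomial.X 0 - MvPolynomial.C l,
        MvPolynomial.X 0 ^ 2 - MvPolynomial.C m * MvPolynomial.X 0 - MvPolynomial.C n
          (R := ℂ) (σ := Fin 3)}) := by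
  have hu : (C (1 + s + t) : MvPolynomial (Fin 2) ℂ) * C (1 + s + t)⁻¹ = 1 := by
    rw [← C_mul, mul_inv_cancel₀ h, C_1]
  have hu' : (C (1 + s + t) : MvPolynomial (Fin 3) ℂ) * C (1 + s + t)⁻¹ = 1 := by
    rw [← C_mul, mul_inv_cancel₀ h, C_1]
  simp only [C_add, C_1] at hu hu'
  constructor
  · intro hf
    have hf' := Ideal.mem_map_of_mem
      (aeval ![X 0, X 1] : MvPolynomial (Fin 2) ℂ →ₐ[ℂ] MvPolynomial (Fin 3) ℂ) hf
    simp only [Ideal.map_span, Set.image_insert_eq, Set.image_singleton, map_add, map_sub,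
      map_mul, map_pow, aeval_X, algHom_C, algebraMap_eq, Matrix.cons_val_zero,
      Matrix.cons_val_one] at hf'
    have hJ := Ideal.span_mono (Set.subset_insert (X 2 - C ((1 + s + t)⁻¹ * (s + k)) * X 0 -
      C ((1 + s + t)⁻¹ * (t + l))) _) hf'
    set J : Ideal (MvPolynomial (Fin 3) ℂ) :=
      Ideal.span (insert (X 2 - C ((1 + s + t)⁻¹ * (s + k)) * X 0 -
        C ((1 + s + t)⁻¹ * (t + l))) {X 1 - C k * X 0 - C l, X 0 ^ 2 - C m * X 0 - C n})
    have hz : X 2 - C ((1 + s + t)⁻¹ * (s + k)) * X 0 - C ((1 + s + t)⁻¹ * (t + l)) ∈ J :=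
      Ideal.subset_span (by simp)
    have hy : X 1 - C k * X 0 - C l ∈ J := Ideal.subset_span (by simp)
    convert J.sub_mem (J.add_mem (J.mul_mem_left (C (1 + s + t)⁻¹) hJ) (J.mul_mem_left (X 1) hz))
      (J.mul_mem_left (C (1 + s + t)⁻¹ * X 1) hy) using 1
    simp only [C_mul, C_add]
    linear_combination (-X 0 ^ 4) * hu'
  · intro hg
    have hI := Ideal.mem_map_of_mem
      (aeval ![X 0, X 1, C ((1 + s + t)⁻¹ * (s + k)) * X 0 + C ((1 + s + t)⁻¹ * (t + l))] :
        MvPolynomial (Fin 3) ℂ →ₐ[ℂ] MvPolynomial (Fin 2) ℂ) hg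
    simp only [Ideal.map_span, Set.image_insert_eq, Set.image_singleton, map_add, map_sub,
      map_mul, map_pow, aeval_X, algHom_C, algebraMap_eq, Matrix.cons_val, add_sub_cancel_left,
      sub_self, Ideal.span_insert_zero] at hI
    set I : Ideal (MvPolynomial (Fin 2) ℂ) :=
      Ideal.span {X 1 - C k * X 0 - C l, X 0 ^ 2 - C m * X 0 - C n}
    have hy : X 1 - C k * X 0 - C l ∈ I := Ideal.subset_span (by simp)
    convert I.add_mem (I.mul_mem_left (C (1 + s + t)) hI) (I.mul_mem_left (X 1) hy) using 1
    simp only [C_add, C_1]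
    linear_combination (-X 1 * ((C s + C k) * X 0 + C t + C l)) * hu
end

section
/- Let P₁ = n·(s·m² + s·k + k² + m²) + t·m²·n + t·l + l² + n²·(1 + s + t) and P₂ = m·(s·m² + s·k + k² + m²) + t·m³ + t·k + s·l + 2·k·l + 2·m·n·(1 + s + t), regarded as polynomials in the six variables s, t, k, l, m, n over ℂ. For every point (s,t,k,l,m,n) ∈ ℂ⁶ with P₁ = 0 and P₂ = 0, the 2×6 Jacobian matrix whose rows are the gradients (∂P₁/∂s, ∂P₁/∂t, ∂P₁/∂k, ∂P₁/∂l, ∂P₁/∂m, ∂P₁/∂n) and (∂P₂/∂s, …, ∂P₂/∂n), evaluated at that point, has rank at most 1 if and only if t = 0, l = 0, n = 0 and s·m² + s·k + k² + m² = 0. -/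
open MvPolynomial

/-- A common zero of the two defining equations at which the gradient of the second is `a` times
that of the first lies in the asserted singular locus. -/
lemma eq_zero_of_gradient_eq_mul {s t k l m n a : ℂ}
    (h₁ : n * (s * m ^ 2 + s * k + k ^ 2 + m ^ 2) + t * m ^ 2 * n + t * l + l ^ 2 +
      n ^ 2 * (1 + s + t) = 0)
    (h₂ : m * (s * m ^ 2 + s * k + k ^ 2 + m ^ 2) + t * m ^ 3 + t * k + s * l + 2 * k * l +
      2 * m * n * (1 + s + t) = 0)
    (hs : m * (m ^ 2 + k) + l + 2 * m * n = a * (n * (m ^ 2 + k + n)))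
    (ht : m ^ 3 + k + 2 * m * n = a * (m ^ 2 * n + l + n ^ 2))
    (hk : m * (s + 2 * k) + (t + 2 * l) = a * (n * (s + 2 * k)))
    (hl : s + 2 * k = a * (t + 2 * l))
    (hm : s * m ^ 2 + s * k + k ^ 2 + m ^ 2 + t * m ^ 2 + 2 * n * (1 + s + t) +
      2 * m ^ 2 * (1 + s + t) = a * (2 * m * n * (1 + s + t)))
    (hn : 2 * m * (1 + s + t) = a * (s * m ^ 2 + s * k + k ^ 2 + m ^ 2 + t * m ^ 2 +
      2 * n * (1 + s + t))) :
    t = 0 ∧ l = 0 ∧ n = 0 ∧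
      s * m ^ 2 + s * k + k ^ 2 + m ^ 2 = 0 := by
  by_cases hc : 1 + a * m - a ^ 2 * n = 0
  · exfalso
    have ha : a ≠ 0 := by rintro rfl; simp at hc
    obtain ⟨b, rfl⟩ : ∃ b, a = b⁻¹ := ⟨a⁻¹, by simp⟩
    have hb : b ≠ 0 := by simpa using ha
    field_simp at hc hs ht hk hl hm hn
    obtain rfl : n = b ^ 2 + m * b := by linear_combination -hc
    obtain rfl : l = b * k - b ^ 4 := by linear_combination -ht
    obtain rfl : b = -1 := by
      have : b ^ 4 * (b + 1) = 0 := by linear_combination -hs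
      have := (mul_eq_zero.1 this).resolve_left (pow_ne_zero 4 hb)
      linear_combination this
    obtain rfl : s = 2 - t := by linear_combination -hl
    have h8 : t = -8 := by grind
    have h6 : t = -6 := by grind
    norm_num [h8] at h6
  · have hτ : t + 2 * l = 0 := by
      refine (mul_eq_zero.1 (?_ : _ * (1 + a * m - a ^ 2 * n) = 0)).resolve_right hc
      linear_combination hk - (m - a * n) * hl
    have hU : s * m ^ 2 + s * k + k ^ 2 + m ^ 2 + t * m ^ 2 + 2 * n * (1 + s + t) = 0 := by
      refine (mul_eq_zero.1 (?_ : _ * (1 + a * m - a ^ 2 * n) = 0)).resolve_right hc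
      linear_combination hm - (m - a * n) * hn
    obtain rfl : t = -2 * l := by linear_combination hτ
    obtain rfl : s = -2 * k := by linear_combination hl + a * hτ
    have hmD : m * (1 + -2 * k + -2 * l) = 0 := by linear_combination (hn + a * hU) / 2
    have hlk : l * k = 0 := by linear_combination (m * hU - h₂) / 2
    have hnD : n ^ 2 * (1 + -2 * k + -2 * l) + l ^ 2 = 0 := by linear_combination n * hU - h₁
    obtain ⟨rfl, rfl⟩ : l = 0 ∧ n = 0 := by grind
    exact ⟨by simp, rfl, rfl, by linear_combination hU⟩

/-- A common zero of the two defining equations at which the gradient of the first vanishes lies in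
the asserted singular locus. -/
lemma eq_zero_of_gradient_eq_zero {s t k l m n : ℂ}
    (h₁ : n * (s * m ^ 2 + s * k + k ^ 2 + m ^ 2) + t * m ^ 2 * n + t * l + l ^ 2 +
      n ^ 2 * (1 + s + t) = 0)
    (h₂ : m * (s * m ^ 2 + s * k + k ^ 2 + m ^ 2) + t * m ^ 3 + t * k + s * l + 2 * k * l +
      2 * m * n * (1 + s + t) = 0)
    (hs : n * (m ^ 2 + k + n) = 0)
    (ht : m ^ 2 * n + l + n ^ 2 = 0)
    (hk : n * (s + 2 * k) = 0)
    (hl : t + 2 * l = 0)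
    (hm : 2 * m * n * (1 + s + t) = 0)
    (hn : s * m ^ 2 + s * k + k ^ 2 + m ^ 2 + t * m ^ 2 + 2 * n * (1 + s + t) = 0) :
    t = 0 ∧ l = 0 ∧ n = 0 ∧ s * m ^ 2 + s * k + k ^ 2 + m ^ 2 = 0 := by
  by_cases h : n = 0
  · subst h
    obtain rfl : l = 0 := by linear_combination ht
    obtain rfl : t = 0 := by linear_combination hl
    exact ⟨rfl, rfl, rfl, by linear_combination hn⟩
  · exfalso
    obtain rfl : t = -2 * l := by linear_combination hl
    obtain rfl : s = -2 * k := by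
      linear_combination (mul_eq_zero.1 hk).resolve_left h
    have hmD : m * (1 + -2 * k + -2 * l) = 0 := by
      refine (mul_eq_zero.1 (?_ : n * _ = 0)).resolve_left h
      linear_combination hm / 2
    have hlk : l * k = 0 := by linear_combination (m * hn - h₂) / 2
    have hnD : n ^ 2 * (1 + -2 * k + -2 * l) + l ^ 2 = 0 := by linear_combination n * hn - h₁
    grind

/-- **The singular locus of the relative Hilbert scheme 𝓗** (Section 4.1 of the paper).
With variables `s = X 0`, `t = X 1`, `k = X 2`, `l = X 3`, `m = X 4`, `n = X 5` in
`ℂ[s,t,k,l,m,n]`, let `P₁`, `P₂` be the two defining equations of 𝓗.  For every point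
`p ∈ ℂ⁶` lying on 𝓗 (i.e. `P₁(p) = P₂(p) = 0`), the `2 × 6` Jacobian matrix of
`(P₁, P₂)` at `p` has rank at most `1` if and only if
`t = l = n = 0` and `s·m² + s·k + k² + m² = 0` at `p`. -/
theorem singular_locus_of_hilbert_scheme
    (P₁ P₂ : MvPolynomial (Fin 6) ℂ)
    (hP₁ : P₁ = X 5 * (X 0 * X 4 ^ 2 + X 0 * X 2 + X 2 ^ 2 + X 4 ^ 2) +
      X 1 * X 4 ^ 2 * X 5 + X 1 * X 3 + X 3 ^ 2 + X 5 ^ 2 * (1 + X 0 + X 1))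
    (hP₂ : P₂ = X 4 * (X 0 * X 4 ^ 2 + X 0 * X 2 + X 2 ^ 2 + X 4 ^ 2) +
      X 1 * X 4 ^ 3 + X 1 * X 2 + X 0 * X 3 + 2 * X 2 * X 3 +
      2 * X 4 * X 5 * (1 + X 0 + X 1))
    (p : Fin 6 → ℂ) (h₁ : eval p P₁ = 0) (h₂ : eval p P₂ = 0) :
    (Matrix.of fun (i : Fin 2) (j : Fin 6) =>
        eval p (pderiv j (![P₁, P₂] i))).rank ≤ 1 ↔
      (p 1 = 0 ∧ p 3 = 0 ∧ p 5 = 0 ∧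
        p 0 * p 4 ^ 2 + p 0 * p 2 + p 2 ^ 2 + p 4 ^ 2 = 0) := by
  set M := Matrix.of fun (i : Fin 2) (j : Fin 6) => eval p (pderiv j (![P₁, P₂] i)) with hM
  have hM₁ : M 0 = ![p 5 * (p 4 ^ 2 + p 2 + p 5), p 4 ^ 2 * p 5 + p 3 + p 5 ^ 2,
      p 5 * (p 0 + 2 * p 2), p 1 + 2 * p 3, 2 * p 4 * p 5 * (1 + p 0 + p 1),
      p 0 * p 4 ^ 2 + p 0 * p 2 + p 2 ^ 2 + p 4 ^ 2 + p 1 * p 4 ^ 2 +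
        2 * p 5 * (1 + p 0 + p 1)] := by
    ext j
    fin_cases j <;> simp [hM, hP₁, pderiv_X] <;> ring
  have hM₂ : M 1 = ![p 4 * (p 4 ^ 2 + p 2) + p 3 + 2 * p 4 * p 5, p 4 ^ 3 + p 2 + 2 * p 4 * p 5,
      p 4 * (p 0 + 2 * p 2) + (p 1 + 2 * p 3), p 0 + 2 * p 2,
      p 0 * p 4 ^ 2 + p 0 * p 2 + p 2 ^ 2 + p 4 ^ 2 + p 1 * p 4 ^ 2 +
        2 * p 5 * (1 + p 0 + p 1) + 2 * p 4 ^ 2 * (1 + p 0 + p 1),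
      2 * p 4 * (1 + p 0 + p 1)] := by
    ext j
    have h2 : pderiv j (2 : MvPolynomial (Fin 6) ℂ) = 0 := (pderiv j).map_natCast 2
    fin_cases j <;> simp at h2 <;> simp [h2, hM, hP₂, pderiv_X] <;> ring
  clear_value M
  simp only [hP₁, hP₂, map_add, map_mul, map_pow, eval_X, map_one, map_ofNat] at h₁ h₂
  constructor
  · intro hr
    have hdep : ¬ LinearIndependent ℂ M.row := fun h => by
      have := h.rank_matrix
      simp at this
      omega
    have hrows : M.row = ![M 0, M 1] := by ext i; fin_cases i <;> rfl
    rw [hrows] at hdep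
    by_cases h0 : M 0 = 0
    · rw [hM₁] at h0
      have hj := fun j => congrFun h0 j
      exact eq_zero_of_gradient_eq_zero h₁ h₂ (hj 0) (hj 1) (hj 2) (hj 3) (hj 4) (hj 5)
    · rw [LinearIndependent.pair_iff' h0] at hdep
      push Not at hdep
      obtain ⟨a, ha⟩ := hdep
      rw [hM₁, hM₂] at ha
      have hj := fun j => (congrFun ha j).symm
      exact eq_zero_of_gradient_eq_mul h₁ h₂ (hj 0) (hj 1) (hj 2) (hj 3) (hj 4) (hj 5)
  · rintro ⟨ht, hl, hn, hQ⟩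
    have h0 : M 0 = 0 := by
      rw [hM₁]
      ext j
      fin_cases j <;> simp [ht, hl, hn, hQ]
    have : M = Matrix.vecMulVec ![0, 1] (M 1) := by
      ext i j
      fin_cases i <;> simp [Matrix.vecMulVec_apply, h0]
    rw [this]
    exact Matrix.rank_vecMulVec_le _ _
end

section
/- Let w ≥ 1, let f₀ ∈ ℂ[x,y], set E₀ = y·f₀ + x^w, and let I be an ideal of ℂ[x,y] with E₀ ∈ I. If ξ₁, ξ₂, ξ₁′, ξ₂′ ∈ ℂ[x,y] satisfy x·ξ₁ + y·ξ₂ = x·ξ₁′ + y·ξ₂′, then (ξ₁ − ξ₁′)·(x·∂f₀/∂x − w·f₀) + (ξ₂ − ξ₂′)·∂E₀/∂x ∈ I. -/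
open MvPolynomial

/-- The only syzygies of two distinct variables are the Koszul ones. -/
theorem exists_eq_X_mul_of_X_mul_add_X_mul_eq_zero {σ R : Type*} [CommRing R] [IsDomain R]
    {i j : σ} (hij : i ≠ j) {a b : MvPolynomial σ R} (h : X i * a + X j * b = 0) :
    ∃ c, a = X j * c ∧ b = -X i * c := by
  have hdvd : (X j : MvPolynomial σ R) ∣ X i * a := ⟨-b, by linear_combination h⟩
  have hX : ¬ (X j : MvPolynomial σ R) ∣ X i := by
    simpa [X_dvd_X] using hij.symm
  obtain ⟨c, rfl⟩ := (X_dvd_mul_iff.mp hdvd).resolve_left hX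
  refine ⟨c, rfl, mul_left_cancel₀ (X_ne_zero j) ?_⟩
  linear_combination h

/-- **Well-definedness of the map Ψ of Remark 4.9 of the paper.**
Let `w ≥ 1`, `f₀ ∈ ℂ[x,y]`, `E₀ = y·f₀ + x^w`, and `I` an ideal of `ℂ[x,y]` with
`E₀ ∈ I`.  If `x·ξ₁ + y·ξ₂ = x·ξ₁′ + y·ξ₂′`, then
`(ξ₁ − ξ₁′)·(x·∂f₀/∂x − w·f₀) + (ξ₂ − ξ₂′)·∂E₀/∂x ∈ I`.
Here `x = X 0`, `y = X 1`, and `∂/∂x = pderiv 0`. -/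
theorem psi_well_defined (w : ℕ) (hw : 1 ≤ w)
    (f₀ : MvPolynomial (Fin 2) ℂ) (I : Ideal (MvPolynomial (Fin 2) ℂ))
    (hE₀ : MvPolynomial.X 1 * f₀ + MvPolynomial.X 0 ^ w ∈ I)
    (ξ₁ ξ₂ ξ₁' ξ₂' : MvPolynomial (Fin 2) ℂ)
    (hξ : MvPolynomial.X 0 * ξ₁ + MvPolynomial.X 1 * ξ₂ =
      MvPolynomial.X 0 * ξ₁' + MvPolynomial.X 1 * ξ₂') :
    (ξ₁ - ξ₁') * (MvPolynomial.X 0 * pderiv (0 : Fin 2) f₀ - (w : MvPolynomial (Fin 2) ℂ) * f₀) +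
      (ξ₂ - ξ₂') * pderiv (0 : Fin 2)
        (MvPolynomial.X 1 * f₀ + MvPolynomial.X 0 ^ w) ∈ I := by
  obtain ⟨n, rfl⟩ : ∃ n, w = n + 1 := ⟨w - 1, by omega⟩
  obtain ⟨c, h₁, h₂⟩ := exists_eq_X_mul_of_X_mul_add_X_mul_eq_zero
    (show (0 : Fin 2) ≠ 1 by decide)
    (show X 0 * (ξ₁ - ξ₁') + X 1 * (ξ₂ - ξ₂') = 0 by linear_combination hξ)
  rw [h₁, h₂]
  have hd : pderiv (0 : Fin 2) (X 1 * f₀ + X 0 ^ (n + 1) : MvPolynomial (Fin 2) ℂ) =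
      X 1 * pderiv 0 f₀ + ((n + 1 : ℕ) : MvPolynomial (Fin 2) ℂ) * X 0 ^ n := by
    simp [Derivation.leibniz_pow]
  rw [hd]
  convert I.mul_mem_left (-c * ((n + 1 : ℕ) : MvPolynomial (Fin 2) ℂ)) hE₀ using 1
  ring
end
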